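/- Let Q be a finite simple quandle whose cardinality is not a prime power, and let G = Inn Q be its inner automorphism group. Then the centre of G is trivial. -/

import Mathlib

universe u v

/-- A quandle: a set with a binary operation `◃` such that every right
translation `x ↦ x ◃ a` is bijective, the operation is right self-distributive,
and every element is idempotent. -/
class Quandle' (Q : Type u) where
  act : Q → Q → Q
  act_bijective : ∀ a : Q, Function.Bijective fun x => act x a
  act_distrib : ∀ a b c : Q, act (act a b) c = act (act a c) (act b c)
  act_self : ∀ a : Q, act a a = a

infixl:65 " ◃ " => Quandle'.act

namespace Quandle'

/-- The right translation by `a`, as a permutation of the quandle. -/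
noncomputable def rho {Q : Type u} [Quandle' Q] (a : Q) : Equiv.Perm Q :=
  Equiv.ofBijective _ (act_bijective a)

/-- The inner automorphism group of a quandle: the subgroup of the symmetric
group generated by the right translations. -/
noncomputable def Inn (Q : Type u) [Quandle' Q] : Subgroup (Equiv.Perm Q) :=
  Subgroup.closure (Set.range (rho : Q → Equiv.Perm Q))

/-- A quandle is connected if its inner automorphism group acts transitively. -/
def IsConnected (Q : Type u) [Quandle' Q] : Prop :=
  ∀ x y : Q, ∃ g ∈ Inn Q, g x = y

/-- Quandle homomorphisms. -/
def IsHom {Q : Type u} {R : Type v} [Quandle' Q] [Quandle' R] (f : Q → R) : Prop :=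
  ∀ a b : Q, f (a ◃ b) = f a ◃ f b

/-- A quandle is simple if it has more than one element and every quandle
homomorphism out of it is either injective or constant. -/
def IsSimple (Q : Type u) [Quandle' Q] : Prop :=
  Nontrivial Q ∧ ∀ (R : Type u) [Quandle' R] (f : Q → R), IsHom f →
    Function.Injective f ∨ ∀ a b : Q, f a = f b

/-- A block for the action of the inner automorphism group. -/
noncomputable def IsBlock (Q : Type u) [Quandle' Q] (B : Set Q) : Prop :=
  ∀ g ∈ Inn Q, ⇑g '' B = B ∨ Disjoint (⇑g '' B) B

/-- A connected quandle is primitive if the action of its inner automorphism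
group preserves no nontrivial partition into blocks. -/
noncomputable def IsPrimitive (Q : Type u) [Quandle' Q] : Prop :=
  IsConnected Q ∧ ∀ B : Set Q, IsBlock Q B → B.Subsingleton ∨ B = Set.univ

end Quandle'

open Quandle'

/-- The conjugacy class of transpositions in the symmetric group `S₅`. -/
abbrev Transposition5 : Type := {σ : Equiv.Perm (Fin 5) // σ.IsSwap}

/-- The conjugation quandle structure `a ◃ b = b⁻¹ * a * b` on the class of
transpositions of `S₅`. -/
instance : Quandle' Transposition5 where
  act a b := ⟨b.1⁻¹ * a.1 * b.1, by
    obtain ⟨x, y, hxy, ha⟩ := a.2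
    refine ⟨b.1⁻¹ x, b.1⁻¹ y, fun h => hxy (b.1⁻¹.injective h), ?_⟩
    rw [ha, Equiv.swap_apply_apply]
    group⟩
  act_bijective a := by
    constructor
    · intro x y h
      have := Subtype.ext_iff.mp h
      simp only [mul_left_cancel_iff, mul_right_cancel_iff] at this
      exact Subtype.ext this
    · intro y
      refine ⟨⟨a.1 * y.1 * a.1⁻¹, ?_⟩, Subtype.ext (by group)⟩
      obtain ⟨x, z, hxz, hy⟩ := y.2
      refine ⟨a.1 x, a.1 z, fun h => hxz (a.1.injective h), ?_⟩
      rw [hy, Equiv.swap_apply_apply]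
  act_distrib a b c := Subtype.ext (by simp only []; group)
  act_self a := Subtype.ext (by simp only []; group)

namespace Quandle'

@[simp]
theorem rho_apply {Q : Type u} [Quandle' Q] (a x : Q) : rho a x = x ◃ a := rfl

/-- The conjugation quandle of a group, `a ◃ b = b * a * b⁻¹`. -/
abbrev conj (G : Type u) [Group G] : Quandle' G where
  act a b := b * a * b⁻¹
  act_bijective b := (MulAut.conj b).bijective
  act_distrib a b c := by group
  act_self a := by simp

theorem rho_act {Q : Type u} [Quandle' Q] (a b : Q) :
    rho (a ◃ b) = rho b * rho a * (rho b)⁻¹ := by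
  rw [eq_mul_inv_iff_mul_eq]
  ext c
  simp [act_distrib c a b]

/-- Elements of `Inn Q` are quandle automorphisms. -/
theorem apply_act_of_mem_inn {Q : Type u} [Quandle' Q] {g : Equiv.Perm Q} (hg : g ∈ Inn Q) :
    ∀ a b : Q, g (a ◃ b) = g a ◃ g b := by
  induction hg using Subgroup.closure_induction with
  | mem g hg =>
    obtain ⟨c, rfl⟩ := hg
    intro a b
    simp [act_distrib a b c]
  | one => simp
  | mul g h _ _ ihg ihh => simp [ihg, ihh]
  | inv g _ ih =>
    intro a b
    rw [Equiv.Perm.inv_eq_iff_eq, ih]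
    simp

/-- If distinct elements have distinct right translations, then `Inn Q` is centreless. -/
theorem center_inn_eq_bot_of_rho_injective {Q : Type u} [Quandle' Q]
    (h : Function.Injective (rho : Q → Equiv.Perm Q)) : Subgroup.center (Inn Q) = ⊥ := by
  rw [Subgroup.eq_bot_iff_forall]
  rintro ⟨z, hz⟩ hc
  refine Subtype.ext (Equiv.ext fun a => h (Equiv.ext fun x => ?_))
  have hcomm : rho a * z = z * rho a :=
    congrArg Subtype.val
      (Subgroup.mem_center_iff.mp hc ⟨rho a, Subgroup.subset_closure ⟨a, rfl⟩⟩)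
  have hx := congrArg (fun f : Equiv.Perm Q => f (z⁻¹ x)) hcomm
  simpa [apply_act_of_mem_inn hz] using hx.symm

/-- If all right translations coincide, then `Inn Q` is trivial. -/
theorem inn_eq_bot_of_rho_const {Q : Type u} [Quandle' Q]
    (h : ∀ a b : Q, rho a = rho b) : Inn Q = ⊥ := by
  rw [Inn, Subgroup.closure_eq_bot_iff]
  rintro _ ⟨a, rfl⟩
  refine Set.mem_singleton_iff.mpr (Equiv.ext fun x => ?_)
  rw [h a x]
  exact act_self x

end Quandle'

/-- For a finite simple quandle `Q` whose cardinality is not a prime power,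
the centre of `G = Inn Q` is trivial. -/
theorem simple_quandle_inn_center_trivial (Q : Type) [Quandle' Q] [Fintype Q]
    (hs : IsSimple Q) (hnpp : ¬ IsPrimePow (Fintype.card Q)) :
    Subgroup.center (Inn Q) = ⊥ := by
  let := conj (Equiv.Perm Q)
  rcases hs.2 (Equiv.Perm Q) rho rho_act with h | h
  · exact center_inn_eq_bot_of_rho_injective h
  · have : Subsingleton (Inn Q) := by
      rw [inn_eq_bot_of_rho_const h]
      infer_instance
    exact Subsingleton.elim _ _
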